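/- arXiv:2409.07719 — 2 statements merged into one kernel-verified Lean document; each statement's English description precedes it below -/
import Mathlib

section
/- In the pairing model, let j, k be integers with 1 ≤ k ≤ n and 1 ≤ j ≤ 2n. Then Σ_{i=1}^{max(j−k, 0)} Pr(X^i > Y^k > X^{i+k}) + (1/2)·Σ_{i=max(j−k+1, 1)}^{min(j, n)} Pr(X^i > Y^{j+1−i}) ≥ (1/2)·Σ_{i=1}^{min(k, j)} Pr(X^i > Y^{j+1−i}). (Empty sums are zero.) -/
open Finset

attribute [local instance] Classical.propDecidable

/-- The `m`-th largest value among `v 0, …, v (n-1)` (with multiplicity);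
equals `0` when `m > n`, matching the convention `X^m = Y^m = 0` for `m > n`. -/
noncomputable def kthLargest {n : ℕ} (v : Fin n → ℝ) (m : ℕ) : ℝ :=
  sSup {x : ℝ | m ≤ (Finset.univ.filter (fun i => x ≤ v i)).card}

/-- The `X`-set of the assignment `σ`: for each pair `(a i, b i)`, the value `a i` if
`σ i = true`, and `b i` otherwise. -/
def Xvals {n : ℕ} (a b : Fin n → ℝ) (σ : Fin n → Bool) : Fin n → ℝ :=
  fun i => if σ i then a i else b i

/-- The `Y`-set of the assignment `σ`: the values not placed in the `X`-set. -/
def Yvals {n : ℕ} (a b : Fin n → ℝ) (σ : Fin n → Bool) : Fin n → ℝ :=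
  fun i => if σ i then b i else a i

/-- `X^m` under assignment `σ`. -/
noncomputable def XS {n : ℕ} (a b : Fin n → ℝ) (σ : Fin n → Bool) (m : ℕ) : ℝ :=
  kthLargest (Xvals a b σ) m

/-- `Y^m` under assignment `σ`. -/
noncomputable def YS {n : ℕ} (a b : Fin n → ℝ) (σ : Fin n → Bool) (m : ℕ) : ℝ :=
  kthLargest (Yvals a b σ) m

/-- The probability of an event under the uniform random assignment: each of the `n` pairs
is independently assigned with probability `1/2` each way. -/
noncomputable def Pr {n : ℕ} (E : (Fin n → Bool) → Prop) : ℝ :=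
  ((Finset.univ.filter E).card : ℝ) / 2 ^ n

/-- The number of assignments satisfying `E`. -/
noncomputable def countAssign {n : ℕ} (E : (Fin n → Bool) → Prop) : ℕ :=
  (Finset.univ.filter E).card

/-- The value selected by the assignment `σ` from the pair weights `f`, summed over all pairs. -/
def selSum {n : ℕ} (f : Fin n → Bool → ℕ) (σ : Fin n → Bool) : ℕ :=
  ∑ i, f i (σ i)

/-- The total of all pair weights. -/
def totalWeight {n : ℕ} (f : Fin n → Bool → ℕ) : ℕ :=
  ∑ i, (f i true + f i false)

lemma countAssign_eq_sum {n : ℕ} (E : (Fin n → Bool) → Prop) [DecidablePred E] :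
    countAssign E = ∑ σ, if E σ then 1 else 0 := by
  rw [← Finset.card_filter, countAssign]
  congr!

lemma countAssign_false (n : ℕ) : countAssign (fun _ : Fin n → Bool => False) = 0 := by
  simp [countAssign]

lemma countAssign_mono {n : ℕ} {E F : (Fin n → Bool) → Prop} (h : ∀ σ, E σ → F σ) :
    countAssign E ≤ countAssign F :=
  Finset.card_le_card (Finset.monotone_filter_right _ fun σ _ => h σ)

lemma Pr_eq_countAssign_div {n : ℕ} (E : (Fin n → Bool) → Prop) :
    Pr E = (countAssign E : ℝ) / 2 ^ n := rfl

/-- Reversing all assignments. -/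
def flipAll (n : ℕ) : Equiv.Perm (Fin n → Bool) :=
  Function.Involutive.toPerm (fun σ i => !σ i) (fun σ => by simp)

lemma flipAll_apply {n : ℕ} (σ : Fin n → Bool) (i : Fin n) : flipAll n σ i = !σ i := rfl

lemma selSum_add_selSum_flipAll {n : ℕ} (f : Fin n → Bool → ℕ) (σ : Fin n → Bool) :
    selSum f σ + selSum f (flipAll n σ) = totalWeight f := by
  unfold selSum totalWeight
  rw [← Finset.sum_add_distrib]
  refine Finset.sum_congr rfl fun i _ => ?_
  cases h : σ i <;> simp [flipAll_apply, h, add_comm]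

lemma countAssign_selSum_lt_succ {n : ℕ} (f : Fin (n + 1) → Bool → ℕ) (x : ℕ) :
    countAssign (fun σ => selSum f σ < x) =
      countAssign (fun σ => selSum (fun i => f i.succ) σ < x - f 0 true) +
      countAssign (fun σ => selSum (fun i => f i.succ) σ < x - f 0 false) := by
  simp only [countAssign_eq_sum]
  rw [← (Fin.consEquiv (fun _ : Fin (n + 1) => Bool)).sum_comp, Fintype.sum_prod_type,
    Fintype.sum_bool]
  have key : ∀ (c : Bool) (σ : Fin n → Bool),
      (selSum f (Fin.consEquiv (fun _ : Fin (n + 1) => Bool) (c, σ)) < x) ↔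
        selSum (fun i => f i.succ) σ < x - f 0 c := by
    intro c σ
    simp only [selSum, Fin.sum_univ_succ, Fin.consEquiv, Equiv.coe_fn_mk, Fin.cons_zero,
      Fin.cons_succ]
    omega
  simp only [key]

/-- The distribution function of a sum of independent selections is superadditive up to
(one more than) the total weight. -/
lemma countAssign_selSum_superadditive {n : ℕ} (f : Fin n → Bool → ℕ) (hf : ∀ i c, f i c ≤ 1)
    (x y : ℕ) (hxy : x + y ≤ totalWeight f + 1) :
    countAssign (fun σ => selSum f σ < x) + countAssign (fun σ => selSum f σ < y) ≤
      countAssign (fun σ => selSum f σ < x + y) := by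
  induction n generalizing x y with
  | zero =>
    have : totalWeight f = 0 := by simp [totalWeight]
    rcases Nat.eq_zero_or_pos x with rfl | hx
    · simp [countAssign_false]
    · obtain rfl : y = 0 := by omega
      simp [countAssign_false]
  | succ n ih =>
    rcases Nat.eq_zero_or_pos x with rfl | hx
    · simp [countAssign_false]
    rcases Nat.eq_zero_or_pos y with rfl | hy
    · simp [countAssign_false]
    have htot : totalWeight f = (f 0 true + f 0 false) + totalWeight (fun i => f i.succ) := by
      simp [totalWeight, Fin.sum_univ_succ]
    have ih' := ih (fun i => f i.succ) (fun i c => hf _ _)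
    simp only [countAssign_selSum_lt_succ]
    set G : ℕ → ℕ := fun z => countAssign (fun σ => selSum (fun i => f i.succ) σ < z) with hG
    have hmono : ∀ z z', z ≤ z' → G z ≤ G z' := fun z z' h =>
      countAssign_mono fun σ hσ => lt_of_lt_of_le hσ h
    change ∀ x y, _ → G x + G y ≤ G (x + y) at ih'
    change (G (x - f 0 true) + G (x - f 0 false)) + (G (y - f 0 true) + G (y - f 0 false)) ≤
      G (x + y - f 0 true) + G (x + y - f 0 false)
    have h1 := hf 0 true
    have h2 := hf 0 false
    have hm := hmono (x + y - 1) (x + y) (by omega)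
    have hm2 := hmono (x + y - 2) (x + y - 1) (by omega)
    have e1 : x + (y - 1) = x + y - 1 := by omega
    have e2 : (x - 1) + y = x + y - 1 := by omega
    have e3 : (x - 1) + (y - 1) = x + y - 2 := by omega
    have i0 := ih' x y
    have i1 := ih' x (y - 1)
    have i2 := ih' (x - 1) y
    have i3 := ih' (x - 1) (y - 1)
    rw [e1] at i1
    rw [e2] at i2
    rw [e3] at i3
    rcases (by omega : f 0 true = 0 ∨ f 0 true = 1) with h | h <;>
    rcases (by omega : f 0 false = 0 ∨ f 0 false = 1) with h' | h' <;>
    rw [h, h'] at htot ⊢ <;> (try simp only [Nat.sub_zero]) <;> omega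

/-- Exchanging the coordinates in `V` between two assignments. -/
def swapOn {n : ℕ} (V : Fin n → Prop) [DecidablePred V] :
    Equiv.Perm ((Fin n → Bool) × (Fin n → Bool)) :=
  Function.Involutive.toPerm
    (fun p => (fun i => if V i then p.2 i else p.1 i, fun i => if V i then p.1 i else p.2 i))
    (fun p => by
      ext i <;> by_cases h : V i <;> simp [h])

lemma swapOn_apply {n : ℕ} (V : Fin n → Prop) [DecidablePred V]
    (p : (Fin n → Bool) × (Fin n → Bool)) :
    swapOn V p =
      (fun i => if V i then p.2 i else p.1 i, fun i => if V i then p.1 i else p.2 i) := rfl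

/-- Weights supported on different pairs give independent selection sums. -/
lemma sum_selSum_indep {n : ℕ} (f g : Fin n → Bool → ℕ)
    (hfg : ∀ i, (∀ c, f i c = 0) ∨ (∀ c, g i c = 0)) (φ : ℕ → ℕ → ℕ) :
    ∑ ρ : Fin n → Bool, ∑ σ : Fin n → Bool, φ (selSum f σ) (selSum g ρ) =
      2 ^ n * ∑ σ : Fin n → Bool, φ (selSum f σ) (selSum g σ) := by
  have h1 : ∑ ρ : Fin n → Bool, ∑ σ : Fin n → Bool, φ (selSum f σ) (selSum g σ) =
      2 ^ n * ∑ σ : Fin n → Bool, φ (selSum f σ) (selSum g σ) := by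
    simp
  rw [← h1, ← Fintype.sum_prod_type', ← Fintype.sum_prod_type',
    ← Equiv.sum_comp (swapOn (fun i => ∀ c, f i c = 0))]
  refine Finset.sum_congr rfl fun p _ => ?_
  have hf : selSum f (swapOn (fun i => ∀ c, f i c = 0) p).2 = selSum f p.2 := by
    refine Finset.sum_congr rfl fun i _ => ?_
    by_cases h : ∀ c, f i c = 0
    · simp [h]
    · simp only [swapOn_apply, h, if_false]
  have hg : selSum g (swapOn (fun i => ∀ c, f i c = 0) p).1 = selSum g p.2 := by
    refine Finset.sum_congr rfl fun i _ => ?_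
    by_cases h : ∀ c, f i c = 0
    · simp only [swapOn_apply, h, implies_true, if_true]
    · simp [(hfg i).resolve_left h]
  rw [hf, hg]

lemma two_mul_countAssign_add_lt_le {n : ℕ} (f g : Fin n → Bool → ℕ) (hf : ∀ i c, f i c ≤ 1)
    (hfg : ∀ i, (∀ c, f i c = 0) ∨ (∀ c, g i c = 0))
    (hle : totalWeight g ≤ totalWeight f + 1) :
    2 * countAssign (fun σ => selSum f σ + selSum g σ < totalWeight g) ≤
      countAssign (fun σ => selSum f σ < totalWeight g) := by
  set K := totalWeight g with hK
  have hind := sum_selSum_indep f g hfg (fun a b => if a + b < K then 1 else 0)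
  rw [← countAssign_eq_sum (fun σ => selSum f σ + selSum g σ < K)] at hind
  have hgK : ∀ ρ, selSum g ρ ≤ K := fun ρ => by
    have := selSum_add_selSum_flipAll g ρ
    omega
  set G : ℕ → ℕ := fun z => countAssign (fun σ => selSum f σ < z) with hG
  have hA : ∑ ρ : Fin n → Bool, ∑ σ : Fin n → Bool,
      (if selSum f σ + selSum g ρ < K then 1 else 0) = ∑ ρ, G (K - selSum g ρ) := by
    refine Finset.sum_congr rfl fun ρ _ => ?_
    rw [hG]
    simp only [countAssign_eq_sum, Nat.lt_sub_iff_add_lt]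
  have hB : ∑ ρ, G (K - selSum g ρ) = ∑ ρ, G (selSum g ρ) := by
    rw [← Equiv.sum_comp (flipAll n)]
    refine Finset.sum_congr rfl fun ρ _ => ?_
    have := selSum_add_selSum_flipAll g ρ
    congr 1
    omega
  have hC : ∑ ρ, G (K - selSum g ρ) + ∑ ρ, G (selSum g ρ) ≤ ∑ _ρ : Fin n → Bool, G K := by
    rw [← Finset.sum_add_distrib]
    refine Finset.sum_le_sum fun ρ _ => ?_
    have h := hgK ρ
    have := countAssign_selSum_superadditive f hf (K - selSum g ρ) (selSum g ρ) (by omega)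
    rwa [Nat.sub_add_cancel h] at this
  have hD : ∑ _ρ : Fin n → Bool, G K = 2 ^ n * G K := by simp
  have hpos : 0 < 2 ^ n := by positivity
  refine Nat.le_of_mul_le_mul_left ?_ hpos
  change 2 ^ n * (2 * _) ≤ 2 ^ n * G K
  rw [← hD]
  linarith

/-- Reversing the assignment of a single pair. -/
def flipAt {n : ℕ} (p : Fin n) : Equiv.Perm (Fin n → Bool) :=
  Function.Involutive.toPerm (fun σ => Function.update σ p (!σ p)) (fun σ => by simp)

lemma flipAt_apply {n : ℕ} (p : Fin n) (σ : Fin n → Bool) :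
    flipAt p σ = Function.update σ p (!σ p) := rfl

lemma selSum_flipAt {n : ℕ} (f : Fin n → Bool → ℕ) (p : Fin n) (hp : ∀ c, f p c = 0)
    (σ : Fin n → Bool) : selSum f (flipAt p σ) = selSum f σ := by
  refine Finset.sum_congr rfl fun i _ => ?_
  by_cases h : i = p
  · subst h; simp [hp]
  · simp [flipAt_apply, Function.update_of_ne h]

/-- If the disjoint sets with indicators `f`, `g` satisfy `|g| ≤ |f| + 1` and `(p, c)` lies in
the second, then having fewer than `|g|` selected elements in the union is at most as likely
as having fewer than `|g|` in the first set while `(p, c)` is not selected. -/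
lemma countAssign_union_lt_le {n : ℕ} (f g : Fin n → Bool → ℕ)
    (hf : ∀ i c, f i c ≤ 1) (hd : ∀ i c, f i c + g i c ≤ 1)
    (hle : totalWeight g ≤ totalWeight f + 1) (p : Fin n) (c : Bool) (hpc : g p c = 1) :
    countAssign (fun σ => selSum f σ + selSum g σ < totalWeight g) ≤
      countAssign (fun σ => selSum f σ < totalWeight g ∧ σ p ≠ c) := by
  set M : Fin n → Prop := fun i => (∃ c, f i c ≠ 0) ∧ ∃ c, g i c ≠ 0 with hM
  set f' : Fin n → Bool → ℕ := fun i c => if M i then 0 else f i c with hf'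
  set g' : Fin n → Bool → ℕ := fun i c => if M i then 0 else g i c with hg'
  set s := ∑ i : Fin n, if M i then 1 else 0 with hs
  have hM1 : ∀ i, M i → ∀ c, f i c + g i c = 1 ∧ f i true + f i false = 1 ∧
      g i true + g i false = 1 := by
    rintro i ⟨⟨c₁, h₁⟩, c₂, h₂⟩ c₃
    have a1 := hd i true
    have a2 := hd i false
    cases c₁ <;> cases c₂ <;> cases c₃ <;> omega
  have hsum : ∀ σ, selSum f σ + selSum g σ = selSum f' σ + selSum g' σ + s := by
    intro σ
    simp only [selSum, hs, ← Finset.sum_add_distrib]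
    refine Finset.sum_congr rfl fun i _ => ?_
    by_cases h : M i
    · simp [hf', hg', h, (hM1 i h (σ i)).1]
    · simp [hf', hg', h]
  have hfs : ∀ σ, selSum f σ ≤ selSum f' σ + s := by
    intro σ
    simp only [selSum, hs, ← Finset.sum_add_distrib]
    refine Finset.sum_le_sum fun i _ => ?_
    by_cases h : M i
    · simp [hf', h, hf]
    · simp [hf', h]
  have htf : totalWeight f = totalWeight f' + s := by
    simp only [totalWeight, hs, ← Finset.sum_add_distrib]
    refine Finset.sum_congr rfl fun i _ => ?_
    by_cases h : M i
    · simp [hf', h, (hM1 i h true).2.1]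
    · simp [hf', h]
  have htg : totalWeight g = totalWeight g' + s := by
    simp only [totalWeight, hs, ← Finset.sum_add_distrib]
    refine Finset.sum_congr rfl fun i _ => ?_
    by_cases h : M i
    · simp [hg', h, (hM1 i h true).2.2]
    · simp [hg', h]
  have hmain := two_mul_countAssign_add_lt_le f' g'
    (fun i c => by by_cases h : M i <;> simp [hf', h, hf])
    (fun i => by
      by_cases h : M i
      · left; simp [hf', h]
      · simp only [hM, not_and_or, not_exists, not_not] at h
        rcases h with h | h
        · left; intro c; simp [hf', h]
        · right; intro c; simp [hg', h])
    (by omega)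
  have hp : ∀ c, f' p c = 0 := by
    intro d
    by_cases h : M p
    · simp [hf', h]
    · have : ∀ c, f p c = 0 := by
        by_contra! hc
        exact h ⟨hc, c, by omega⟩
      simp [hf', this]
  have hhalf : countAssign (fun σ => selSum f' σ < totalWeight g') =
      2 * countAssign (fun σ => selSum f' σ < totalWeight g' ∧ σ p ≠ c) := by
    have h2 : countAssign (fun σ => selSum f' σ < totalWeight g' ∧ σ p ≠ c) =
        countAssign (fun σ => selSum f' σ < totalWeight g' ∧ σ p = c) := by
      rw [countAssign_eq_sum, countAssign_eq_sum, ← Equiv.sum_comp (flipAt p)]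
      refine Finset.sum_congr rfl fun σ _ => ?_
      rw [selSum_flipAt f' p hp]
      have : flipAt p σ p ≠ c ↔ σ p = c := by
        simp only [flipAt_apply, Function.update_self]
        cases c <;> simp
      exact if_congr (and_congr_right fun _ => this) rfl rfl
    rw [two_mul]
    nth_rewrite 2 [h2]
    simp only [countAssign_eq_sum, ← Finset.sum_add_distrib]
    refine Finset.sum_congr rfl fun σ _ => ?_
    by_cases h1 : selSum f' σ < totalWeight g' <;> by_cases h3 : σ p = c <;> simp [h1, h3]
  have e1 : countAssign (fun σ => selSum f σ + selSum g σ < totalWeight g) ≤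
      countAssign (fun σ => selSum f' σ + selSum g' σ < totalWeight g') :=
    countAssign_mono fun σ hσ => by
      have := hsum σ
      omega
  have e2 : countAssign (fun σ => selSum f' σ < totalWeight g' ∧ σ p ≠ c) ≤
      countAssign (fun σ => selSum f σ < totalWeight g ∧ σ p ≠ c) :=
    countAssign_mono fun σ hσ => by
      have := hfs σ
      exact ⟨by omega, hσ.2⟩
  omega

/-- The number of entries of `v` strictly exceeding `v e`. -/
noncomputable def descRank {α : Type*} [Fintype α] (v : α → ℝ) (e : α) : ℕ :=
  (Finset.univ.filter fun e' => v e < v e').card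

section descRank

variable {α : Type*} [Fintype α] (v : α → ℝ)

lemma descRank_lt_card (e : α) : descRank v e < Fintype.card α := by
  rw [← Finset.card_univ]
  refine Finset.card_lt_card (Finset.filter_ssubset.2 ⟨e, Finset.mem_univ _, lt_irrefl _⟩)

lemma descRank_le_descRank {e e' : α} (h : v e' ≤ v e) : descRank v e ≤ descRank v e' :=
  Finset.card_le_card (Finset.monotone_filter_right _ fun _ _ hx => lt_of_le_of_lt h hx)

lemma descRank_lt_descRank {e e' : α} (h : v e' < v e) : descRank v e < descRank v e' := by
  refine Finset.card_lt_card ⟨Finset.monotone_filter_right _ fun _ _ hx => h.trans hx, fun hs => ?_⟩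
  have := hs (Finset.mem_filter.2 ⟨Finset.mem_univ e, h⟩)
  exact lt_irrefl _ (Finset.mem_filter.1 this).2

lemma descRank_le_iff {e e' : α} : descRank v e ≤ descRank v e' ↔ v e' ≤ v e :=
  ⟨fun h => not_lt.1 fun h' => absurd (descRank_lt_descRank v h') (not_lt.2 h),
    descRank_le_descRank v⟩

variable {v}

lemma descRank_injective (hv : Function.Injective v) : Function.Injective (descRank v) :=
  fun _ _ h => hv (le_antisymm ((descRank_le_iff v).1 h.ge) ((descRank_le_iff v).1 h.le))

lemma image_descRank (hv : Function.Injective v) :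
    Finset.univ.image (descRank v) = Finset.range (Fintype.card α) := by
  refine Finset.eq_of_subset_of_card_le ?_ ?_
  · intro m hm
    obtain ⟨e, -, rfl⟩ := Finset.mem_image.1 hm
    exact Finset.mem_range.2 (descRank_lt_card v e)
  · rw [Finset.card_image_of_injective _ (descRank_injective hv), Finset.card_range,
      Finset.card_univ]

lemma exists_descRank_eq (hv : Function.Injective v) {m : ℕ} (hm : m < Fintype.card α) :
    ∃ e, descRank v e = m := by
  have : m ∈ Finset.univ.image (descRank v) := by
    rw [image_descRank hv]
    exact Finset.mem_range.2 hm
  obtain ⟨e, -, he⟩ := Finset.mem_image.1 this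
  exact ⟨e, he⟩

lemma card_descRank_lt (hv : Function.Injective v) {m : ℕ} (hm : m ≤ Fintype.card α) :
    (Finset.univ.filter fun e => descRank v e < m).card = m := by
  rw [← Finset.card_image_of_injective _ (descRank_injective hv),
    ← Finset.filter_image (p := (· < m)), image_descRank hv]
  have : (Finset.range (Fintype.card α)).filter (· < m) = Finset.range m := by
    ext x
    simp only [Finset.mem_filter, Finset.mem_range]
    omega
  rw [this, Finset.card_range]

/-- The entries of rank below `m` are those above a threshold. -/
lemma exists_threshold [Nonempty α] (hv : Function.Injective v) {m : ℕ} (hm : 1 ≤ m) :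
    ∃ e₀, ∀ e, descRank v e < m ↔ v e₀ ≤ v e := by
  have hpos : 0 < Fintype.card α := Fintype.card_pos
  obtain ⟨e₀, he₀⟩ := exists_descRank_eq hv (m := min m (Fintype.card α) - 1) (by omega)
  refine ⟨e₀, fun e => ?_⟩
  rw [← descRank_le_iff v, he₀]
  have := descRank_lt_card v e
  omega

end descRank

lemma le_kthLargest_iff {n : ℕ} (v : Fin n → ℝ) {m : ℕ} (hm : 1 ≤ m) {z : ℝ} (hz : 0 < z) :
    z ≤ kthLargest v m ↔ m ≤ (Finset.univ.filter (fun i => z ≤ v i)).card := by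
  set A : Set ℝ := {x : ℝ | m ≤ (Finset.univ.filter (fun i => x ≤ v i)).card} with hA
  have hlower : ∀ x y, x ≤ y → y ∈ A → x ∈ A := fun x y hxy hy =>
    le_trans (show m ≤ _ from hy)
      (Finset.card_le_card (Finset.monotone_filter_right _ fun _ _ h => hxy.trans h))
  have hclosed : IsClosed A := by
    have : A = ⋃ T ∈ (Finset.univ : Finset (Fin n)).powersetCard m,
        ⋂ i ∈ T, Set.Iic (v i) := by
      ext x
      simp only [hA, Set.mem_ofPred_eq, Set.mem_iUnion, Set.mem_iInter, Set.mem_Iic,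
        Finset.mem_powersetCard]
      constructor
      · intro h
        obtain ⟨T, hT, hc⟩ := Finset.exists_subset_card_eq h
        exact ⟨T, ⟨Finset.subset_univ _, hc⟩, fun i hi => (Finset.mem_filter.1 (hT hi)).2⟩
      · rintro ⟨T, ⟨-, hc⟩, hT⟩
        rw [← hc]
        exact Finset.card_le_card fun i hi => Finset.mem_filter.2 ⟨Finset.mem_univ _, hT i hi⟩
    rw [this]
    exact Set.Finite.isClosed_biUnion (Finset.finite_toSet _) fun T _ =>
      isClosed_biInter fun i _ => isClosed_Iic
  have hbdd : BddAbove A := by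
    obtain ⟨M, hM⟩ := (Set.finite_range v).bddAbove
    refine ⟨M, fun x hx => ?_⟩
    obtain ⟨i, hi⟩ := Finset.card_pos.1 (lt_of_lt_of_le hm hx)
    exact (Finset.mem_filter.1 hi).2.trans (hM ⟨i, rfl⟩)
  constructor
  · intro h
    have hne : A.Nonempty := by
      by_contra hne
      have h0 : kthLargest v m = 0 := by
        change sSup A = 0
        rw [Set.not_nonempty_iff_eq_empty.1 hne, Real.sSup_empty]
      linarith
    exact hlower z _ h (hclosed.csSup_mem hne hbdd)
  · intro h
    exact le_csSup hbdd h

/-- The value of pair `i` that is placed in the `Y`-set by the assignments with `σ i = c`. -/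
def pairVal {n : ℕ} (a b : Fin n → ℝ) (e : Fin n × Bool) : ℝ :=
  if e.2 then b e.1 else a e.1

/-- The indicator of the `m` largest of the `2n` values. -/
noncomputable def topInd {n : ℕ} (a b : Fin n → ℝ) (m : ℕ) (i : Fin n) (c : Bool) : ℕ :=
  if descRank (pairVal a b) (i, c) < m then 1 else 0

section topInd

variable {n : ℕ} {a b : Fin n → ℝ}

lemma pairVal_injective
    (hdistinct : Function.Injective (Sum.elim a b : Fin n ⊕ Fin n → ℝ)) :
    Function.Injective (pairVal a b) := by
  rintro ⟨i, c⟩ ⟨i', c'⟩ h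
  cases c <;> cases c'
  · simpa using @hdistinct (Sum.inl i) (Sum.inl i') h
  · simpa using @hdistinct (Sum.inl i) (Sum.inr i') h
  · simpa using @hdistinct (Sum.inr i) (Sum.inl i') h
  · simpa using @hdistinct (Sum.inr i) (Sum.inr i') h

lemma pairVal_pos (ha : ∀ i, 0 < a i) (hb : ∀ i, 0 < b i) (e : Fin n × Bool) :
    0 < pairVal a b e := by
  unfold pairVal
  split_ifs
  exacts [hb _, ha _]

lemma topInd_le_one (m : ℕ) (i : Fin n) (c : Bool) : topInd a b m i c ≤ 1 := by
  unfold topInd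
  split_ifs <;> omega

lemma topInd_mono {m m' : ℕ} (h : m ≤ m') (i : Fin n) (c : Bool) :
    topInd a b m i c ≤ topInd a b m' i c := by
  unfold topInd
  split_ifs <;> omega

lemma selSum_topInd_mono {m m' : ℕ} (h : m ≤ m') (σ : Fin n → Bool) :
    selSum (topInd a b m) σ ≤ selSum (topInd a b m') σ :=
  Finset.sum_le_sum fun i _ => topInd_mono h i (σ i)

lemma selSum_topInd_le (m : ℕ) (σ : Fin n → Bool) : selSum (topInd a b m) σ ≤ n := by
  calc selSum (topInd a b m) σ ≤ ∑ _i : Fin n, 1 :=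
        Finset.sum_le_sum fun i _ => topInd_le_one m i (σ i)
    _ = n := by simp

lemma selSum_topInd_of_le {m : ℕ} (h : 2 * n ≤ m) (σ : Fin n → Bool) :
    selSum (topInd a b m) σ = n := by
  have : ∀ i c, topInd a b m i c = 1 := fun i c => by
    have := descRank_lt_card (pairVal a b) (i, c)
    simp only [Fintype.card_prod, Fintype.card_fin, Fintype.card_bool] at this
    exact if_pos (by omega)
  simp [selSum, this]

lemma totalWeight_topInd
    (hdistinct : Function.Injective (Sum.elim a b : Fin n ⊕ Fin n → ℝ))
    {m : ℕ} (h : m ≤ 2 * n) : totalWeight (topInd a b m) = m := by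
  have := card_descRank_lt (pairVal_injective hdistinct) (m := m)
    (by simp only [Fintype.card_prod, Fintype.card_fin, Fintype.card_bool]; omega)
  rw [Finset.card_filter, Fintype.sum_prod_type] at this
  simp only [Fintype.sum_bool] at this
  exact this

lemma totalWeight_topInd_le
    (hdistinct : Function.Injective (Sum.elim a b : Fin n ⊕ Fin n → ℝ))
    (m : ℕ) : totalWeight (topInd a b m) ≤ m := by
  rcases le_total m (2 * n) with h | h
  · exact (totalWeight_topInd hdistinct h).le
  · refine le_trans ?_ h
    calc totalWeight (topInd a b m) ≤ ∑ _i : Fin n, 2 :=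
          Finset.sum_le_sum fun i _ => add_le_add (topInd_le_one m i true) (topInd_le_one m i false)
      _ = 2 * n := by simp [mul_comm]

lemma exists_threshold_card (hn : 1 ≤ n) (ha : ∀ i, 0 < a i) (hb : ∀ i, 0 < b i)
    (hdistinct : Function.Injective (Sum.elim a b : Fin n ⊕ Fin n → ℝ))
    {m : ℕ} (hm : 1 ≤ m) (σ : Fin n → Bool) :
    ∃ z : ℝ, (∀ l, 1 ≤ l → (z ≤ YS a b σ l ↔ l ≤ selSum (topInd a b m) σ)) ∧
      ∀ i, 1 ≤ i → (z ≤ XS a b σ i ↔ i ≤ selSum (topInd a b m) (flipAll n σ)) := by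
  have : Nonempty (Fin n) := ⟨⟨0, hn⟩⟩
  obtain ⟨e₀, he₀⟩ := exists_threshold (pairVal_injective hdistinct) hm
  have hz := pairVal_pos ha hb e₀
  refine ⟨pairVal a b e₀, fun l hl => ?_, fun i hi => ?_⟩
  · rw [YS, le_kthLargest_iff _ hl hz, Finset.card_filter]
    simp only [selSum, topInd, he₀]
    rfl
  · rw [XS, le_kthLargest_iff _ hi hz, Finset.card_filter]
    have : ∀ p, Xvals a b σ p = pairVal a b (p, flipAll n σ p) := fun p => by
      cases h : σ p <;> simp [Xvals, pairVal, flipAll_apply, h]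
    simp only [selSum, topInd, he₀, this]

lemma YS_lt_XS_iff (hn : 1 ≤ n) (ha : ∀ i, 0 < a i) (hb : ∀ i, 0 < b i)
    (hdistinct : Function.Injective (Sum.elim a b : Fin n ⊕ Fin n → ℝ))
    {m i l : ℕ} (hi : 1 ≤ i) (hl : 1 ≤ l) (hm : i + l = m + 1) (hm2 : m ≤ 2 * n)
    (σ : Fin n → Bool) :
    YS a b σ l < XS a b σ i ↔ selSum (topInd a b m) σ < l := by
  obtain ⟨z, hY, hX⟩ := exists_threshold_card hn ha hb hdistinct (m := m) (by omega) σ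
  have hsum := selSum_add_selSum_flipAll (topInd a b m) σ
  rw [totalWeight_topInd hdistinct hm2] at hsum
  specialize hY l hl
  specialize hX i hi
  constructor
  · intro h
    by_contra! hc
    have h1 := hY.2 hc
    have h2 : ¬ z ≤ XS a b σ i := fun h => by have := hX.1 h; omega
    linarith
  · intro h
    have h1 : ¬ z ≤ YS a b σ l := fun h' => by have := hY.1 h'; omega
    have h2 := hX.2 (by omega)
    linarith

lemma XS_lt_YS_of_le (hn : 1 ≤ n) (ha : ∀ i, 0 < a i) (hb : ∀ i, 0 < b i)
    (hdistinct : Function.Injective (Sum.elim a b : Fin n ⊕ Fin n → ℝ))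
    {m i l : ℕ} (hi : 1 ≤ i) (hl : 1 ≤ l) (hm : i + l = m + 1)
    (σ : Fin n → Bool) (h : l ≤ selSum (topInd a b m) σ) :
    XS a b σ i < YS a b σ l := by
  obtain ⟨z, hY, hX⟩ := exists_threshold_card hn ha hb hdistinct (m := m) (by omega) σ
  have hsum := selSum_add_selSum_flipAll (topInd a b m) σ
  have hle := totalWeight_topInd_le hdistinct m
  have h1 := (hY l hl).2 h
  have h2 : ¬ z ≤ XS a b σ i := fun h' => by have := (hX i hi).1 h'; omega
  linarith

lemma countAssign_topInd_lt_le
    (hdistinct : Function.Injective (Sum.elim a b : Fin n ⊕ Fin n → ℝ))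
    {j k : ℕ} (hkn : k ≤ n) (hkj : k ≤ j) (hk : 1 ≤ k)
    (p : Fin n) (c : Bool) (hpc : descRank (pairVal a b) (p, c) = j) :
    countAssign (fun σ => selSum (topInd a b (j + k)) σ < k) ≤
      countAssign (fun σ => selSum (topInd a b j) σ < k ∧ σ p ≠ c) := by
  rcases lt_or_ge (2 * n) (j + k) with h | h
  · refine countAssign_mono fun σ hσ => ?_
    rw [selSum_topInd_of_le h.le] at hσ
    omega
  set g : Fin n → Bool → ℕ := fun i c => topInd a b (j + k) i c - topInd a b j i c with hg
  have hfg : ∀ i c, topInd a b j i c + g i c = topInd a b (j + k) i c := fun i c =>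
    Nat.add_sub_cancel' (topInd_mono (by omega) i c)
  have hsum : ∀ σ, selSum (topInd a b j) σ + selSum g σ = selSum (topInd a b (j + k)) σ := by
    intro σ
    simp only [selSum, ← Finset.sum_add_distrib, hfg]
  have htj := totalWeight_topInd hdistinct (m := j) (by omega)
  have htg : totalWeight g = k := by
    have h1 : totalWeight (topInd a b j) + totalWeight g = totalWeight (topInd a b (j + k)) := by
      simp only [totalWeight, ← Finset.sum_add_distrib, ← hfg]
      exact Finset.sum_congr rfl fun i _ => by ring
    rw [htj, totalWeight_topInd hdistinct h] at h1
    omega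
  have := countAssign_union_lt_le (topInd a b j) g (topInd_le_one j)
    (fun i c => by rw [hfg]; exact topInd_le_one _ i c) (by omega) p c
    (by simp [hg, topInd, hpc, Nat.one_le_iff_ne_zero.1 hk])
  simpa only [hsum, htg] using this

lemma selSum_topInd_succ
    (hdistinct : Function.Injective (Sum.elim a b : Fin n ⊕ Fin n → ℝ))
    {j : ℕ} (p : Fin n) (c : Bool) (hpc : descRank (pairVal a b) (p, c) = j)
    (σ : Fin n → Bool) :
    selSum (topInd a b (j + 1)) σ = selSum (topInd a b j) σ + if σ p = c then 1 else 0 := by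
  have h1 : (if σ p = c then 1 else 0) = ∑ i, if i = p ∧ σ i = c then 1 else 0 := by
    rw [Finset.sum_eq_single p]
    · simp
    · intro i _ hi
      simp [hi]
    · simp
  rw [h1]
  simp only [selSum, ← Finset.sum_add_distrib]
  refine Finset.sum_congr rfl fun i _ => ?_
  have h2 : descRank (pairVal a b) (i, σ i) = j ↔ i = p ∧ σ i = c := by
    rw [← hpc, (descRank_injective (pairVal_injective hdistinct)).eq_iff, Prod.mk.injEq]
  rw [← if_congr h2 rfl rfl]
  unfold topInd
  split_ifs <;> omega

lemma countAssign_add_sum_ge (hdistinct : Function.Injective (Sum.elim a b : Fin n ⊕ Fin n → ℝ))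
    {k : ℕ} (hkn : k ≤ n) (hk : 1 ≤ k) (t : ℕ) (ht : k + t ≤ 2 * n) :
    k * 2 ^ n ≤
      2 * (∑ i ∈ Finset.Icc 1 t, countAssign (fun σ =>
        k ≤ selSum (topInd a b (i + k + k - 1)) σ ∧ selSum (topInd a b (i + k - 1)) σ < k)) +
      2 * ∑ σ, (k - selSum (topInd a b (k + t)) σ) := by
  induction t with
  | zero =>
    have h1 : ∑ σ, (k - selSum (topInd a b k) σ) = ∑ σ, selSum (topInd a b k) σ := by
      rw [← Equiv.sum_comp (flipAll n)]
      refine Finset.sum_congr rfl fun σ _ => ?_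
      have := selSum_add_selSum_flipAll (topInd a b k) σ
      rw [totalWeight_topInd hdistinct (by omega)] at this
      omega
    have h2 : ∑ σ, (k - selSum (topInd a b k) σ) + ∑ σ, selSum (topInd a b k) σ = k * 2 ^ n := by
      rw [← Finset.sum_add_distrib]
      have : ∀ σ, k - selSum (topInd a b k) σ + selSum (topInd a b k) σ = k := fun σ => by
        have := selSum_add_selSum_flipAll (topInd a b k) σ
        rw [totalWeight_topInd hdistinct (by omega)] at this
        omega
      simp [this, mul_comm]
    simp only [add_zero]
    omega
  | succ t ih =>
    specialize ih (by omega)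
    obtain ⟨⟨p, c⟩, hpc⟩ := exists_descRank_eq (pairVal_injective hdistinct) (m := k + t)
      (by simp only [Fintype.card_prod, Fintype.card_fin, Fintype.card_bool]; omega)
    have hcore := countAssign_topInd_lt_le hdistinct hkn (Nat.le_add_right k t) hk p c hpc
    rw [Finset.sum_Icc_succ_top (by omega), show t + 1 + k + k - 1 = k + t + k by omega,
      show t + 1 + k - 1 = k + t by omega, ← add_assoc k t 1]
    have hstep : ∑ σ, (k - selSum (topInd a b (k + t)) σ) +
          countAssign (fun σ => selSum (topInd a b (k + t)) σ < k ∧ σ p ≠ c) ≤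
        countAssign (fun σ => k ≤ selSum (topInd a b (k + t + k)) σ ∧
          selSum (topInd a b (k + t)) σ < k) +
        ∑ σ, (k - selSum (topInd a b (k + t + 1)) σ) +
        countAssign (fun σ => selSum (topInd a b (k + t + k)) σ < k) := by
      simp only [countAssign_eq_sum, ← Finset.sum_add_distrib]
      refine Finset.sum_le_sum fun σ _ => ?_
      have hm := selSum_topInd_mono (a := a) (b := b) (Nat.le_add_right (k + t) k) σ
      rw [selSum_topInd_succ hdistinct p c hpc]
      by_cases h1 : σ p = c <;> simp only [h1, ne_eq, not_true, not_false_eq_true, and_true,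
        and_false, if_true, if_false] <;> split_ifs <;> omega
    omega

end topInd

lemma sum_Icc_indicator_eq {j k n d : ℕ} (hdj : d ≤ j) (hdn : j ≤ n + d) (hkj : k ≤ j) :
    ∑ i ∈ Finset.Icc (j - k + 1) (min j n), (if d < j + 1 - i then 1 else 0) = k - d := by
  rw [← Finset.card_filter]
  have : (Finset.Icc (j - k + 1) (min j n)).filter (fun i => d < j + 1 - i) =
      Finset.Icc (j - k + 1) (j - d) := by
    ext i
    simp only [Finset.mem_filter, Finset.mem_Icc]
    omega
  rw [this, Nat.card_Icc]
  omega

lemma sum_Icc_one_indicator_eq {j k d : ℕ} (hdj : d ≤ j) :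
    ∑ i ∈ Finset.Icc 1 k, (if d < j + 1 - i then 1 else 0) = min k (j - d) := by
  rw [← Finset.card_filter]
  have : (Finset.Icc 1 k).filter (fun i => d < j + 1 - i) = Finset.Icc 1 (min k (j - d)) := by
    ext i
    simp only [Finset.mem_filter, Finset.mem_Icc]
    omega
  rw [this, Nat.card_Icc]
  omega

/-- For `1 ≤ k ≤ n` and `1 ≤ j ≤ 2n`:
`Σ_{i=1}^{max(j−k,0)} Pr(X^i > Y^k > X^{i+k})
  + (1/2)·Σ_{i=max(j−k+1,1)}^{min(j,n)} Pr(X^i > Y^{j+1−i})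
  ≥ (1/2)·Σ_{i=1}^{min(k,j)} Pr(X^i > Y^{j+1−i})`. -/
theorem pick_count_lower_bound
    (n : ℕ) (hn : 1 ≤ n) (a b : Fin n → ℝ)
    (ha : ∀ i, 0 < a i) (hb : ∀ i, 0 < b i)
    (hdistinct : Function.Injective (Sum.elim a b : Fin n ⊕ Fin n → ℝ))
    (j k : ℕ) (hk1 : 1 ≤ k) (hkn : k ≤ n) (hj1 : 1 ≤ j) (hj2n : j ≤ 2 * n) :
    (∑ i ∈ Finset.Icc 1 (j - k),
        Pr (fun σ => XS a b σ (i + k) < YS a b σ k ∧ YS a b σ k < XS a b σ i))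
      + (1 / 2) * ∑ i ∈ Finset.Icc (j - k + 1) (min j n),
          Pr (fun σ => YS a b σ (j + 1 - i) < XS a b σ i)
    ≥ (1 / 2) * ∑ i ∈ Finset.Icc 1 (min k j),
        Pr (fun σ => YS a b σ (j + 1 - i) < XS a b σ i) := by
  rcases lt_or_ge j k with hjk | hkj
  · rw [show j - k = 0 by omega, show min j n = j by omega, show min k j = j by omega]
    simp
  have hcount : ∑ i ∈ Finset.Icc 1 k, countAssign (fun σ => YS a b σ (j + 1 - i) < XS a b σ i) ≤
      2 * (∑ i ∈ Finset.Icc 1 (j - k), countAssign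
        (fun σ => XS a b σ (i + k) < YS a b σ k ∧ YS a b σ k < XS a b σ i)) +
      ∑ i ∈ Finset.Icc (j - k + 1) (min j n),
        countAssign (fun σ => YS a b σ (j + 1 - i) < XS a b σ i) := by
    have hYX : ∀ i ∈ Finset.Icc 1 j,
        countAssign (fun σ => YS a b σ (j + 1 - i) < XS a b σ i) =
          ∑ σ, if selSum (topInd a b j) σ < j + 1 - i then 1 else 0 := by
      intro i hi
      rw [Finset.mem_Icc] at hi
      rw [countAssign_eq_sum]
      exact Finset.sum_congr rfl fun σ _ => if_congr
        (YS_lt_XS_iff hn ha hb hdistinct hi.1 (by omega) (by omega) hj2n σ) rfl rfl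
    have hd : ∀ σ, selSum (topInd a b j) σ + selSum (topInd a b j) (flipAll n σ) = j := fun σ => by
      rw [selSum_add_selSum_flipAll, totalWeight_topInd hdistinct hj2n]
    have hR : ∑ i ∈ Finset.Icc 1 k, countAssign (fun σ => YS a b σ (j + 1 - i) < XS a b σ i) =
        ∑ σ, min k (selSum (topInd a b j) σ) := by
      rw [Finset.sum_congr rfl fun i hi => hYX i (by rw [Finset.mem_Icc] at hi ⊢; omega),
        Finset.sum_comm, ← Equiv.sum_comp (flipAll n)]
      refine Finset.sum_congr rfl fun σ _ => ?_
      have := hd σ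
      rw [sum_Icc_one_indicator_eq (by omega)]
      omega
    have hL : ∑ i ∈ Finset.Icc (j - k + 1) (min j n),
        countAssign (fun σ => YS a b σ (j + 1 - i) < XS a b σ i) =
        ∑ σ, (k - selSum (topInd a b j) σ) := by
      rw [Finset.sum_congr rfl fun i hi => hYX i (by rw [Finset.mem_Icc] at hi ⊢; omega),
        Finset.sum_comm]
      refine Finset.sum_congr rfl fun σ _ => ?_
      have h1 := hd σ
      have h2 := selSum_topInd_le (a := a) (b := b) j (flipAll n σ)
      exact sum_Icc_indicator_eq (by omega) (by omega) hkj
    have hM : ∑ i ∈ Finset.Icc 1 (j - k), countAssign (fun σ =>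
          k ≤ selSum (topInd a b (i + k + k - 1)) σ ∧ selSum (topInd a b (i + k - 1)) σ < k) ≤
        ∑ i ∈ Finset.Icc 1 (j - k), countAssign
          (fun σ => XS a b σ (i + k) < YS a b σ k ∧ YS a b σ k < XS a b σ i) := by
      refine Finset.sum_le_sum fun i hi => countAssign_mono fun σ hσ => ?_
      rw [Finset.mem_Icc] at hi
      exact ⟨XS_lt_YS_of_le hn ha hb hdistinct (by omega) hk1 (by omega) σ hσ.1,
        (YS_lt_XS_iff hn ha hb hdistinct hi.1 hk1 (by omega) (by omega) σ).2 hσ.2⟩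
    have hmain := countAssign_add_sum_ge hdistinct hkn hk1 (j - k) (by omega)
    rw [show k + (j - k) = j by omega] at hmain
    have hsplit : ∑ σ, min k (selSum (topInd a b j) σ) + ∑ σ, (k - selSum (topInd a b j) σ) =
        k * 2 ^ n := by
      rw [← Finset.sum_add_distrib]
      have : ∀ σ, min k (selSum (topInd a b j) σ) + (k - selSum (topInd a b j) σ) = k :=
        fun σ => by omega
      simp [this, mul_comm]
    rw [hR, hL]
    omega
  rw [min_eq_left hkj]
  simp only [Pr_eq_countAssign_div, ← Finset.sum_div, ge_iff_le, ← Nat.cast_sum]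
  rw [← mul_div_assoc, ← mul_div_assoc, ← add_div]
  gcongr
  have hcast : ((∑ i ∈ Finset.Icc 1 k,
      countAssign (fun σ => YS a b σ (j + 1 - i) < XS a b σ i) : ℕ) : ℝ) ≤ _ :=
    Nat.cast_le.2 hcount
  rw [Nat.cast_add, Nat.cast_mul, Nat.cast_two] at hcast
  linarith
end

section
/- For each integer k ≥ 1, let λ_k > 0 be a real number such that E[min(X_k, k)]/k = Pr(X_k ≤ k−1), where X_k is a Poisson random variable with mean λ_k. Then (k − λ_k)/√(k·log k) → 1 as k → ∞, where log denotes the natural logarithm. -/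
open Real Filter Finset

/-- The probability that a Poisson variable of mean `l` equals `m`. -/
noncomputable def poissonWeight (l : ℝ) (m : ℕ) : ℝ := Real.exp (-l) * l ^ m / m.factorial

lemma poissonWeight_nonneg {l : ℝ} (hl : 0 ≤ l) (m : ℕ) : 0 ≤ poissonWeight l m := by
  unfold poissonWeight; positivity

lemma poissonWeight_pos {l : ℝ} (hl : 0 < l) (m : ℕ) : 0 < poissonWeight l m := by
  unfold poissonWeight; positivity

lemma hasSum_poissonWeight (l : ℝ) : HasSum (poissonWeight l) 1 := by
  have h := (NormedSpace.expSeries_div_hasSum_exp l).mul_left (Real.exp (-l))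
  rw [← Real.exp_eq_exp_ℝ, ← Real.exp_add, neg_add_cancel, Real.exp_zero] at h
  refine h.congr_fun ?_
  intro m
  simp [poissonWeight, mul_div_assoc]

lemma succ_mul_poissonWeight_succ (l : ℝ) (m : ℕ) :
    ((m : ℝ) + 1) * poissonWeight l (m + 1) = l * poissonWeight l m := by
  unfold poissonWeight
  rw [Nat.factorial_succ]
  have : (m.factorial : ℝ) ≠ 0 := by positivity
  push_cast
  field_simp
  ring

lemma sum_range_succ_mul_poissonWeight (l : ℝ) (k : ℕ) :
    ∑ m ∈ range (k + 1), (m : ℝ) * poissonWeight l m = l * ∑ m ∈ range k, poissonWeight l m := by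
  rw [sum_range_succ', mul_sum]
  simp [succ_mul_poissonWeight_succ]

lemma tsum_min_mul_poissonWeight (l : ℝ) (k : ℕ) :
    ∑' m : ℕ, (↑(min m k) : ℝ) * poissonWeight l m
      = k - ∑ m ∈ range k, ((k : ℝ) - m) * poissonWeight l m := by
  have h1 := (hasSum_poissonWeight l).mul_left (k : ℝ)
  have h2 : HasSum (fun m => if m ∈ range k then ((k : ℝ) - m) * poissonWeight l m else 0)
      (∑ m ∈ range k, if m ∈ range k then ((k : ℝ) - m) * poissonWeight l m else 0) :=
    hasSum_sum_of_ne_finset_zero fun m hm => by simp only [hm, if_false]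
  have h3 : ∑ m ∈ range k, (if m ∈ range k then ((k : ℝ) - m) * poissonWeight l m else 0)
      = ∑ m ∈ range k, ((k : ℝ) - m) * poissonWeight l m :=
    sum_congr rfl fun m hm => by simp only [hm, if_true]
  rw [h3] at h2
  have h4 := (h1.sub h2).tsum_eq
  rw [mul_one] at h4
  rw [← h4]
  congr 1
  ext m
  by_cases hm : m < k
  · simp [hm, min_eq_left hm.le]; ring
  · simp [hm, min_eq_right (not_lt.mp hm)]

/-- The balance equation rewritten as `(k - l) P(X < k) = k P(X > k)`. -/
lemma sub_mul_sum_eq_tail_of_balance {l : ℝ} {k : ℕ} (hk : 1 ≤ k)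
    (h : (∑' m : ℕ, (↑(min m k) : ℝ) * poissonWeight l m) / k
      = ∑ m ∈ range k, poissonWeight l m) :
    ((k : ℝ) - l) * ∑ m ∈ range k, poissonWeight l m
      = k * (1 - ∑ m ∈ range (k + 1), poissonWeight l m) := by
  have hk' : (k : ℝ) ≠ 0 := by positivity
  rw [tsum_min_mul_poissonWeight, div_eq_iff hk'] at h
  have h1 := sum_range_succ_mul_poissonWeight l k
  rw [sum_range_succ] at h1
  simp only [sub_mul, sum_sub_distrib, ← mul_sum] at h
  rw [sum_range_succ]
  linarith

lemma sum_poissonWeight_le_one {l : ℝ} (hl : 0 ≤ l) (s : Finset ℕ) :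
    ∑ m ∈ s, poissonWeight l m ≤ 1 :=
  sum_le_hasSum s (fun m _ => poissonWeight_nonneg hl m) (hasSum_poissonWeight l)

lemma log_one_sub_le {x : ℝ} (h0 : 0 ≤ x) (h1 : x < 1) : log (1 - x) ≤ -x - x ^ 2 / 2 := by
  have h := sum_le_hasSum (range 2) (fun i _ => by positivity)
    (Real.hasSum_pow_div_log_of_abs_lt_one (x := x) (by rwa [abs_of_nonneg h0]))
  norm_num [sum_range_succ] at h
  linarith

lemma mul_log_le {z : ℝ} (hz : 1 ≤ z) : z * log z ≤ (z ^ 2 - 1) / 2 := by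
  have hz0 : 0 < z := by linarith
  have h := Real.self_le_sinh_iff.2 (log_nonneg hz)
  rw [Real.sinh_log hz0] at h
  calc z * log z ≤ z * ((z - z⁻¹) / 2) := by gcongr
    _ = _ := by field_simp

/-- Chernoff bound for the upper tail of a Poisson variable. -/
lemma one_sub_sum_poissonWeight_le {l : ℝ} {k : ℕ} (hl : 0 < l) (hlk : l ≤ k) :
    1 - ∑ m ∈ range k, poissonWeight l m ≤ Real.exp (-(((k : ℝ) - l) ^ 2 / (2 * k))) := by
  have hk : (0 : ℝ) < k := hl.trans_le hlk
  have h2 : HasSum (fun m => if m ∈ range k then poissonWeight l m else 0)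
      (∑ m ∈ range k, if m ∈ range k then poissonWeight l m else 0) :=
    hasSum_sum_of_ne_finset_zero fun m hm => by simp only [hm, if_false]
  have h3 : ∑ m ∈ range k, (if m ∈ range k then poissonWeight l m else 0)
      = ∑ m ∈ range k, poissonWeight l m :=
    sum_congr rfl fun m hm => by simp only [hm, if_true]
  rw [h3] at h2
  have h4 := (hasSum_poissonWeight k).mul_left (Real.exp (k - l) * (l / k) ^ k)
  have h5 := hasSum_le (fun m => ?_) (hasSum_poissonWeight l) (h2.add h4)
  · have hx := log_one_sub_le (x := 1 - l / k)
      (by rw [sub_nonneg, div_le_one hk]; exact hlk) (by linarith [div_pos hl hk])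
    have h6 : (l / k) ^ k = Real.exp (k * log (l / k)) := by
      rw [← Real.log_pow, Real.exp_log (by positivity)]
    rw [mul_one, h6, ← Real.exp_add] at h5
    have h7 : (k : ℝ) - l + k * log (l / k) ≤ -(((k : ℝ) - l) ^ 2 / (2 * k)) := by
      rw [sub_sub_cancel] at hx
      calc (k : ℝ) - l + k * log (l / k)
          ≤ k - l + k * (-(1 - l / k) - (1 - l / k) ^ 2 / 2) := by gcongr
        _ = _ := by field_simp; ring
    linarith [Real.exp_le_exp.2 h7]
  · by_cases hm : m < k
    · simp only [mem_range, hm, if_true]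
      have := poissonWeight_nonneg hk.le m
      have : 0 ≤ Real.exp (k - l) * (l / k) ^ k * poissonWeight k m := by positivity
      linarith
    · simp only [mem_range, hm, if_false, zero_add]
      have hle : (l / k) ^ m ≤ (l / k) ^ k :=
        pow_le_pow_of_le_one (by positivity) ((div_le_one hk).2 hlk) (not_lt.mp hm)
      calc poissonWeight l m = Real.exp (k - l) * (l / k) ^ m * poissonWeight k m := by
            unfold poissonWeight
            rw [div_pow, sub_eq_add_neg, Real.exp_add, Real.exp_neg (k : ℝ)]
            have := Real.exp_ne_zero (k : ℝ)
            field_simp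
        _ ≤ _ := by
            have := poissonWeight_nonneg hk.le m
            gcongr

lemma factorial_le_stirling {n : ℕ} (hn : 1 ≤ n) :
    (n.factorial : ℝ) ≤ Real.exp 1 * √n * (n / Real.exp 1) ^ n := by
  obtain ⟨m, rfl⟩ : ∃ m, n = m + 1 := ⟨n - 1, by omega⟩
  have h := Stirling.stirlingSeq'_antitone (Nat.zero_le m)
  simp only [Function.comp, Nat.succ_eq_add_one, zero_add, Stirling.stirlingSeq_one] at h
  unfold Stirling.stirlingSeq at h
  rw [div_le_iff₀ (by positivity)] at h
  refine h.trans_eq ?_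
  rw [Real.sqrt_mul (by norm_num)]
  have : √(2 : ℝ) ≠ 0 := by positivity
  field_simp

lemma le_poissonWeight {l : ℝ} {n : ℕ} (hl : 0 < l) (hln : l ≤ n) :
    Real.exp (-(((n : ℝ) - l) ^ 2 / (2 * l))) / (Real.exp 1 * √n) ≤ poissonWeight l n := by
  have hn : (0 : ℝ) < n := hl.trans_le hln
  have hn1 : 1 ≤ n := by exact_mod_cast hn
  have hlog := mul_log_le ((one_le_div hl).2 hln)
  have hexp : -(((n : ℝ) - l) ^ 2 / (2 * l)) ≤ -l + n * log (l / n) + n := by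
    have e : log (l / n) = -log (n / l) := by rw [← Real.log_inv, inv_div]
    have h := mul_le_mul_of_nonneg_left hlog hl.le
    have e1 : l * (n / l * log (n / l)) = n * log (n / l) := by field_simp
    have e2 : l * (((n / l) ^ 2 - 1) / 2) = ((n : ℝ) - l) ^ 2 / (2 * l) + n - l := by
      field_simp; ring
    rw [e1, e2] at h
    rw [e]
    linarith
  calc Real.exp (-(((n : ℝ) - l) ^ 2 / (2 * l))) / (Real.exp 1 * √n)
      ≤ Real.exp (-l + n * log (l / n) + n) / (Real.exp 1 * √n) := by gcongr
    _ = Real.exp (-l) * l ^ n / (Real.exp 1 * √n * (n / Real.exp 1) ^ n) := by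
        rw [Real.exp_add, Real.exp_add, ← Real.log_pow, Real.exp_log (by positivity), div_pow,
          div_pow, ← Real.exp_nat_mul, mul_one]
        field_simp
    _ ≤ poissonWeight l n := by
        unfold poissonWeight
        gcongr
        exact factorial_le_stirling hn1

lemma poissonWeight_le_of_le {l : ℝ} {i n : ℕ} (hl : 0 < l) (hli : l ≤ i) (hin : i ≤ n) :
    poissonWeight l n ≤ poissonWeight l i := by
  induction n, hin using Nat.le_induction with
  | base => rfl
  | succ n hn ih =>
    refine le_trans ?_ ih
    have h := succ_mul_poissonWeight_succ l n
    have h0 := poissonWeight_nonneg hl.le n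
    have hn' : (i : ℝ) ≤ n := by exact_mod_cast hn
    have h1 : l * poissonWeight l n ≤ ((n : ℝ) + 1) * poissonWeight l n := by gcongr; linarith
    rw [← h] at h1
    exact le_of_mul_le_mul_left h1 (by positivity)

lemma mul_poissonWeight_add_le_tail {l : ℝ} {k : ℕ} (hl : 0 < l) (hlk : l ≤ k) (J : ℕ) :
    J * poissonWeight l (k + J) ≤ 1 - ∑ m ∈ range (k + 1), poissonWeight l m := by
  have h := sum_poissonWeight_le_one hl.le (range (k + 1 + J))
  rw [sum_range_add] at h
  have h2 : ∑ _x ∈ range J, poissonWeight l (k + J)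
      ≤ ∑ x ∈ range J, poissonWeight l (k + 1 + x) := by
    refine sum_le_sum fun x hx => poissonWeight_le_of_le hl ?_ ?_
    · push_cast; have : (0 : ℝ) ≤ x := by positivity
      linarith
    · have := mem_range.1 hx; omega
  rw [sum_const, card_range, nsmul_eq_mul] at h2
  linarith

lemma mul_exp_neg_half_log {x : ℝ} (hx : 0 < x) : x * Real.exp (-(log x / 2)) = √x := by
  have h1 : Real.exp (-(log x / 2)) = (√x)⁻¹ := by
    rw [Real.exp_neg, Real.sqrt_eq_rpow, Real.rpow_def_of_pos hx]
    congr 2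
    ring
  rw [h1, ← div_eq_mul_inv, Real.div_sqrt]

lemma nine_mul_sqrt_lt_exp {ε L : ℝ} (hε : 0 < ε) (hL : 1 ≤ L) (hεL : 288 < ε ^ 2 * L) :
    9 * √L < Real.exp (ε * L / 4) := by
  have hq := Real.quadratic_le_exp_of_nonneg (x := ε * L / 4) (by positivity)
  have hsL : √L ≤ L := Real.sqrt_le_iff.2 ⟨by linarith, by nlinarith⟩
  have h0 : 0 ≤ ε * L := by positivity
  have h9 : 288 * L ≤ ε ^ 2 * L * L := by gcongr
  linarith

section Balanced

variable {l : ℝ} {k : ℕ}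

lemma lt_of_balance (hk : 1 ≤ k) (hl : 0 < l)
    (h : ((k : ℝ) - l) * ∑ m ∈ range k, poissonWeight l m
      = k * (1 - ∑ m ∈ range (k + 1), poissonWeight l m)) : l < k := by
  have hS : 0 < ∑ m ∈ range k, poissonWeight l m :=
    sum_pos (fun m _ => poissonWeight_pos hl m) ⟨0, mem_range.2 hk⟩
  have hT : 0 < 1 - ∑ m ∈ range (k + 1), poissonWeight l m := by
    have := sum_poissonWeight_le_one hl.le (range (k + 1 + 1))
    rw [sum_range_succ] at this
    linarith [poissonWeight_pos hl (k + 1)]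
  have hk' : (0 : ℝ) < k := by positivity
  have : 0 < ((k : ℝ) - l) * ∑ m ∈ range k, poissonWeight l m := h ▸ mul_pos hk' hT
  linarith [pos_of_mul_pos_left this hS.le]

lemma sub_le_of_balance {ε : ℝ} (hk : 1 ≤ k) (hl : 0 < l) (hε : 0 < ε)
    (h : ((k : ℝ) - l) * ∑ m ∈ range k, poissonWeight l m
      = k * (1 - ∑ m ∈ range (k + 1), poissonWeight l m))
    (hL2 : 2 ≤ log k) (hLε : 2 ≤ ε * log k) :
    (k : ℝ) - l ≤ (1 + ε) * √(k * log k) := by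
  by_contra! hc
  have hlk := lt_of_balance hk hl h
  have hk' : (0 : ℝ) < k := by positivity
  have hch := one_sub_sum_poissonWeight_le hl hlk.le
  set L := log (k : ℝ)
  set S := ∑ m ∈ range k, poissonWeight l m
  rw [sum_range_succ] at h
  have hp := poissonWeight_nonneg hl.le k
  have hD : √(k * L) ^ 2 = k * L := Real.sq_sqrt (by positivity)
  have hsq : (1 + ε) * L / 2 ≤ ((k : ℝ) - l) ^ 2 / (2 * k) := by
    rw [div_le_div_iff₀ (by norm_num) (by positivity)]
    have h1 : ((1 + ε) * √(k * L)) ^ 2 ≤ ((k : ℝ) - l) ^ 2 := by gcongr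
    rw [mul_pow, hD] at h1
    have h2 : 0 ≤ ε * (1 + ε) * (k * L) := by positivity
    nlinarith
  have hT : 1 - S ≤ Real.exp (-(L / 2)) * Real.exp (-(ε * L / 2)) := by
    refine hch.trans ?_
    rw [← Real.exp_add, Real.exp_le_exp]
    linarith
  have hexp1 : Real.exp (-1) < 1 / 2 := by
    have := Real.exp_neg_one_lt_d9; linarith
  have he : Real.exp (-(ε * L / 2)) < 1 / 2 :=
    (Real.exp_le_exp.2 (by linarith)).trans_lt hexp1
  have he2 : Real.exp (-(L / 2)) < 1 / 2 :=
    (Real.exp_le_exp.2 (by linarith)).trans_lt hexp1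
  have hkL : (k : ℝ) * Real.exp (-(L / 2)) = √k := mul_exp_neg_half_log hk'
  have hE := Real.exp_pos (-(L / 2))
  have hE2 := Real.exp_pos (-(ε * L / 2))
  have hS : 1 / 2 ≤ S := by nlinarith
  have hkD : √k ≤ √(k * L) := Real.sqrt_le_sqrt (by nlinarith)
  have hsk : 0 < √(k : ℝ) := Real.sqrt_pos.2 hk'
  have hDk : √k ≤ (k : ℝ) - l := by nlinarith
  have h1 : √k * (1 / 2) ≤ ((k : ℝ) - l) * S := by gcongr
  have h2 : (k : ℝ) * (1 - (S + poissonWeight l k))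
      ≤ k * (Real.exp (-(L / 2)) * Real.exp (-(ε * L / 2))) := by gcongr; linarith
  rw [← mul_assoc, hkL] at h2
  nlinarith

lemma le_sub_of_balance {ε : ℝ} (hk : 1 ≤ k) (hl : 0 < l) (hε : 0 < ε) (hε1 : ε < 1)
    (h : ((k : ℝ) - l) * ∑ m ∈ range k, poissonWeight l m
      = k * (1 - ∑ m ∈ range (k + 1), poissonWeight l m))
    (hLε : 288 < ε ^ 2 * log k) (hLk : log k ≤ (ε / 2) ^ 2 * k) :
    (1 - ε) * √(k * log k) ≤ (k : ℝ) - l := by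
  by_contra! hc
  have hlk := lt_of_balance hk hl h
  have hk' : (0 : ℝ) < k := by positivity
  have hJ := mul_poissonWeight_add_le_tail hl hlk.le k.sqrt
  set L := log (k : ℝ)
  set J := k.sqrt
  have hS := sum_poissonWeight_le_one hl.le (range k)
  set S := ∑ m ∈ range k, poissonWeight l m
  have hL1 : 1 ≤ L := by nlinarith
  have hD : √(k * L) = √k * √L := Real.sqrt_mul hk'.le L
  have hsk : 0 < √(k : ℝ) := Real.sqrt_pos.2 hk'
  have hsL : 0 < √L := Real.sqrt_pos.2 (by linarith)
  have hk2 : √(k : ℝ) ^ 2 = k := Real.sq_sqrt hk'.le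
  have hL2 : √L ^ 2 = L := Real.sq_sqrt (by linarith)
  have hJ1 : 1 ≤ J := Nat.le_sqrt.2 (by simpa using hk)
  have hJ1' : (1 : ℝ) ≤ J := by exact_mod_cast hJ1
  have hJle : (J : ℝ) ≤ √k := Real.nat_sqrt_le_real_sqrt
  have hJge : √(k : ℝ) ≤ 2 * J := by
    have := Real.real_sqrt_le_nat_sqrt_succ (a := k)
    linarith
  have hLε2 : 2 ≤ ε * √L := by
    refine le_of_sq_le_sq ?_ (by positivity)
    rw [mul_pow, hL2]; linarith
  have hD1 : √(k * L) ≤ ε / 2 * k := by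
    refine Real.sqrt_le_iff.2 ⟨by positivity, ?_⟩
    nlinarith
  have hd : ((k + J : ℕ) : ℝ) - l ≤ (1 - ε / 2) * √(k * L) := by
    push_cast
    have : √(k : ℝ) * 2 ≤ √k * (ε * √L) := by gcongr
    rw [hD] at hc ⊢
    nlinarith
  have hlge : (1 - ε / 2) * k ≤ l := by
    have : 0 ≤ √(k * L) := Real.sqrt_nonneg _
    nlinarith
  have hquad : (((k + J : ℕ) : ℝ) - l) ^ 2 / (2 * l) ≤ (1 - ε / 2) * L / 2 := by
    rw [div_le_div_iff₀ (by positivity) (by norm_num)]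
    have h0 : 0 ≤ ((k + J : ℕ) : ℝ) - l := by push_cast; linarith
    have h1 : (((k + J : ℕ) : ℝ) - l) ^ 2 ≤ ((1 - ε / 2) * √(k * L)) ^ 2 := by gcongr
    rw [mul_pow, Real.sq_sqrt (by positivity)] at h1
    have h2 : (1 - ε / 2) * L * ((1 - ε / 2) * k) ≤ (1 - ε / 2) * L * l :=
      mul_le_mul_of_nonneg_left hlge (mul_nonneg (by linarith) (by linarith))
    nlinarith
  have hp := le_poissonWeight (n := k + J) hl (by push_cast; linarith)
  have hn : √((k + J : ℕ) : ℝ) ≤ 3 * J := by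
    refine Real.sqrt_le_iff.2 ⟨by positivity, ?_⟩
    push_cast
    nlinarith
  have hn0 : 0 < √((k + J : ℕ) : ℝ) := Real.sqrt_pos.2 (by push_cast; linarith)
  have he3 : Real.exp 1 ≤ 3 := by have := Real.exp_one_lt_d9; linarith
  have hkL : (k : ℝ) * Real.exp (-(L / 2)) = √k := mul_exp_neg_half_log hk'
  have hlow : Real.exp (-((1 - ε / 2) * L / 2)) / 9 ≤ J * poissonWeight l (k + J) := by
    calc Real.exp (-((1 - ε / 2) * L / 2)) / 9
        = J * (Real.exp (-((1 - ε / 2) * L / 2)) / (3 * (3 * J))) := by field_simp; norm_num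
      _ ≤ J * (Real.exp (-((((k + J : ℕ) : ℝ) - l) ^ 2 / (2 * l)))
            / (Real.exp 1 * √((k + J : ℕ) : ℝ))) := by gcongr
      _ ≤ _ := by gcongr
  have hup : ((k : ℝ) - l) * S ≤ √(k * L) := by
    have h1 : ((k : ℝ) - l) * S ≤ ((k : ℝ) - l) * 1 := by gcongr
    have : 0 ≤ ε * √(k * L) := by positivity
    linarith
  have hfin : (k : ℝ) * (Real.exp (-((1 - ε / 2) * L / 2)) / 9) ≤ √k * √L := by
    rw [← hD]
    refine le_trans ?_ hup
    rw [h]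
    gcongr
    exact hlow.trans hJ
  have hsplit : Real.exp (-((1 - ε / 2) * L / 2))
      = Real.exp (-(L / 2)) * Real.exp (ε * L / 4) := by
    rw [← Real.exp_add]; congr 1; ring
  rw [hsplit, mul_div_assoc, ← mul_assoc, hkL] at hfin
  have hE := le_of_mul_le_mul_left hfin hsk
  linarith [nine_mul_sqrt_lt_exp hε hL1 hLε]

end Balanced

/-- If for each `k ≥ 1`, `λ_k > 0` satisfies the balance equation
`E[min(X_k, k)]/k = Pr(X_k ≤ k−1)` for `X_k ~ Poisson(λ_k)`, then
`(k − λ_k)/√(k·log k) → 1` as `k → ∞`. -/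
theorem poisson_balance_lambda_asymptotics (lam : ℕ → ℝ)
    (hpos : ∀ k : ℕ, 1 ≤ k → 0 < lam k)
    (hbal : ∀ k : ℕ, 1 ≤ k →
      (∑' m : ℕ, (↑(min m k) : ℝ) * (Real.exp (-(lam k)) * lam k ^ m / m.factorial)) / k
        = ∑ m ∈ Finset.range k, Real.exp (-(lam k)) * lam k ^ m / m.factorial) :
    Tendsto (fun k : ℕ => ((k : ℝ) - lam k) / Real.sqrt (k * Real.log k))
      atTop (nhds 1) := by
  rw [Metric.tendsto_nhds]
  intro r hr
  obtain ⟨ε, hε, hε1, hεr⟩ : ∃ ε : ℝ, 0 < ε ∧ ε < 1 ∧ ε < r :=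
    ⟨min r 1 / 2, by positivity, by linarith [min_le_right r 1],
      by linarith [min_le_left r 1, lt_min hr one_pos]⟩
  have hlog : Tendsto (fun k : ℕ => log (k : ℝ)) atTop atTop :=
    Real.tendsto_log_atTop.comp tendsto_natCast_atTop_atTop
  have hlittle : ∀ᶠ k : ℕ in atTop, ‖log (k : ℝ)‖ ≤ (ε / 2) ^ 2 * ‖(k : ℝ)‖ :=
    tendsto_natCast_atTop_atTop.eventually
      (Real.isLittleO_log_id_atTop.bound (by positivity : 0 < (ε / 2) ^ 2))
  filter_upwards [hlittle, hlog.eventually_ge_atTop 2, hlog.eventually_ge_atTop (2 / ε),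
    hlog.eventually_gt_atTop (288 / ε ^ 2), eventually_ge_atTop 1] with k h1 h2 h3 h4 hk
  rw [div_le_iff₀' hε] at h3
  rw [div_lt_iff₀' (by positivity)] at h4
  have hk' : (0 : ℝ) < k := by positivity
  rw [Real.norm_of_nonneg (by linarith), Real.norm_of_nonneg hk'.le] at h1
  have hb := sub_mul_sum_eq_tail_of_balance hk (hbal k hk)
  have hup := sub_le_of_balance hk (hpos k hk) hε hb h2 h3
  have hlo := le_sub_of_balance hk (hpos k hk) hε hε1 hb h4 h1
  have hD : 0 < √(k * log k) := Real.sqrt_pos.2 (by positivity)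
  rw [← div_le_iff₀ hD] at hup
  rw [← le_div_iff₀ hD] at hlo
  rw [Real.dist_eq]
  exact (abs_le.2 ⟨by linarith, by linarith⟩ : |_| ≤ ε).trans_lt hεr
end
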